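/- Assume (f_i)_{i=1}^N satisfies the open set condition. Then for every k ≥ 1, e_{N_{k,r},r}(μ)^r ≤ Σ_{σ∈Λ_{k,r}} h(σ). -/

import Mathlib

open MeasureTheory Filter

/-- The `n`-th quantization error of order `r` of a Borel measure `P` on `ℝ^q`:
the infimum of `(∫ d(x,α)^r dP)^{1/r}` over finite sets `α` with `1 ≤ card α ≤ n`. -/
noncomputable def quantErr {q : ℕ} (P : Measure (EuclideanSpace ℝ (Fin q)))
    (n : ℕ) (r : ℝ) : ℝ :=
  sInf ((fun α : Finset (EuclideanSpace ℝ (Fin q)) =>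
      (∫ x, Metric.infDist x (α : Set (EuclideanSpace ℝ (Fin q))) ^ r ∂P) ^ (1 / r)) ''
    {α : Finset (EuclideanSpace ℝ (Fin q)) | α.Nonempty ∧ α.card ≤ n})

/-- Product of weights `g` along a word `σ` (equals `1` for the empty word). -/
noncomputable def prodw {N : ℕ} (g : Fin N → ℝ) (σ : List (Fin N)) : ℝ := (σ.map g).prod

/-- The composition `f_{σ_1} ∘ ⋯ ∘ f_{σ_n}` along a word `σ`. -/
def wordMap {q N : ℕ} (f : Fin N → EuclideanSpace ℝ (Fin q) → EuclideanSpace ℝ (Fin q))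
    (σ : List (Fin N)) : EuclideanSpace ℝ (Fin q) → EuclideanSpace ℝ (Fin q) :=
  σ.foldr (fun i g => f i ∘ g) id

/-- `h(σ) = h^{(1)}(σ) + h^{(2)}(σ)` where
`h^{(1)}(σ) = Σ_{j=0}^{|σ|-1} p0 p_{σ|_j} t_{σ^{(l)}_{-j}} s_σ^r` and `h^{(2)}(σ) = p_σ s_σ^r`. -/
noncomputable def hfun {N : ℕ} (r p0 : ℝ) (s t p : Fin N → ℝ) (σ : List (Fin N)) : ℝ :=
  (∑ j ∈ Finset.range σ.length, p0 * prodw p (σ.take j) * prodw t (σ.drop j)) * prodw s σ ^ r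
    + prodw p σ * prodw s σ ^ r

/-- `η̲_r := min_{1 ≤ i ≤ N} min{p0 t_i + p_i, t_i} · s_i^r`. -/
noncomputable def etaLow {N : ℕ} (r p0 : ℝ) (s t p : Fin N → ℝ) : ℝ :=
  ⨅ i, min (p0 * t i + p i) (t i) * s i ^ r

/-- The finite maximal antichain `Λ_{k,r} = {σ : h(σ|_{|σ|-1}) ≥ η̲_r/k > h(σ)}`. -/
def Lam {N : ℕ} (r p0 : ℝ) (s t p : Fin N → ℝ) (k : ℕ) : Set (List (Fin N)) :=
  {σ | σ ≠ [] ∧ etaLow r p0 s t p / k ≤ hfun r p0 s t p σ.dropLast ∧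
    hfun r p0 s t p σ < etaLow r p0 s t p / k}

/-- `a(x) = Σ_i (t_i s_i^r)^{x/(x+r)}` (also used for `b` with `p` in place of `t`). -/
noncomputable def afun {N : ℕ} (r : ℝ) (s t : Fin N → ℝ) (x : ℝ) : ℝ :=
  ∑ i, (t i * s i ^ r) ^ (x / (x + r))

section Words

variable {N : ℕ}

@[simp]
lemma prodw_nil (g : Fin N → ℝ) : prodw g [] = 1 := rfl

@[simp]
lemma prodw_append_singleton (g : Fin N → ℝ) (σ : List (Fin N)) (i : Fin N) :
    prodw g (σ ++ [i]) = prodw g σ * g i := by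
  simp [prodw]

lemma prodw_pos {g : Fin N → ℝ} (hg : ∀ i, 0 < g i) (σ : List (Fin N)) : 0 < prodw g σ := by
  refine List.prod_pos fun a ha => ?_
  obtain ⟨i, -, rfl⟩ := List.mem_map.1 ha
  exact hg i

/-- The total mass that `μ` receives along `σ` from the copies of `ν`, i.e. the factor of
`s_σ ^ r` in `h^{(1)}(σ)`. -/
noncomputable def inhomWeight (p0 : ℝ) (t p : Fin N → ℝ) (σ : List (Fin N)) : ℝ :=
  ∑ j ∈ Finset.range σ.length, p0 * prodw p (σ.take j) * prodw t (σ.drop j)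

@[simp]
lemma inhomWeight_nil (p0 : ℝ) (t p : Fin N → ℝ) : inhomWeight p0 t p [] = 0 := by
  simp [inhomWeight]

lemma inhomWeight_append_singleton (p0 : ℝ) (t p : Fin N → ℝ) (σ : List (Fin N)) (i : Fin N) :
    inhomWeight p0 t p (σ ++ [i]) = (inhomWeight p0 t p σ + p0 * prodw p σ) * t i := by
  have key : ∀ j ∈ Finset.range σ.length,
      p0 * prodw p ((σ ++ [i]).take j) * prodw t ((σ ++ [i]).drop j)
        = p0 * prodw p (σ.take j) * prodw t (σ.drop j) * t i := by
    intro j hj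
    have hj' : j ≤ σ.length := (Finset.mem_range.1 hj).le
    rw [List.take_append_of_le_length hj', List.drop_append_of_le_length hj',
      prodw_append_singleton]
    ring
  rw [inhomWeight, List.length_append, List.length_singleton, Finset.sum_range_succ,
    Finset.sum_congr rfl key, ← Finset.sum_mul, List.take_left, List.drop_left, inhomWeight]
  simp [prodw]
  ring

lemma inhomWeight_nonneg {p0 : ℝ} {t p : Fin N → ℝ} (hp0 : 0 < p0) (ht : ∀ i, 0 < t i)
    (hp : ∀ i, 0 < p i) (σ : List (Fin N)) : 0 ≤ inhomWeight p0 t p σ :=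
  Finset.sum_nonneg fun _ _ =>
    mul_nonneg (mul_nonneg hp0.le (prodw_pos hp _).le) (prodw_pos ht _).le

lemma hfun_eq (r p0 : ℝ) (s t p : Fin N → ℝ) (σ : List (Fin N)) :
    hfun r p0 s t p σ = (inhomWeight p0 t p σ + prodw p σ) * prodw s σ ^ r :=
  (add_mul _ _ _).symm

lemma hfun_nonneg {r p0 : ℝ} {s t p : Fin N → ℝ} (hp0 : 0 < p0) (hs : ∀ i, 0 < s i)
    (ht : ∀ i, 0 < t i) (hp : ∀ i, 0 < p i) (σ : List (Fin N)) : 0 ≤ hfun r p0 s t p σ := by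
  rw [hfun_eq]
  exact mul_nonneg (add_nonneg (inhomWeight_nonneg hp0 ht hp σ) (prodw_pos hp σ).le)
    (Real.rpow_nonneg (prodw_pos hs σ).le r)

lemma hfun_nil (r p0 : ℝ) (s t p : Fin N → ℝ) : hfun r p0 s t p [] = 1 := by
  simp [hfun_eq]

lemma hfun_append_singleton_le {r p0 : ℝ} {s t p : Fin N → ℝ} (hr : 0 < r) (hp0 : 0 < p0)
    (hs : ∀ i, 0 < s i) (ht : ∀ i, 0 < t i) (hp : ∀ i, 0 < p i) (ht1 : ∑ i, t i = 1)
    (hp1 : p0 + ∑ i, p i = 1) {b : ℝ} (hb : ∀ i, s i ≤ b) (σ : List (Fin N)) (i : Fin N) :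
    hfun r p0 s t p (σ ++ [i]) ≤ hfun r p0 s t p σ * b ^ r := by
  have hti : t i ≤ 1 :=
    ht1 ▸ Finset.single_le_sum (fun j _ => (ht j).le) (Finset.mem_univ i)
  have hpi : p i ≤ ∑ i, p i :=
    Finset.single_le_sum (fun j _ => (hp j).le) (Finset.mem_univ i)
  have hA := inhomWeight_nonneg hp0 ht hp σ
  have hP := prodw_pos hp σ
  have hweight : inhomWeight p0 t p (σ ++ [i]) + prodw p (σ ++ [i])
      ≤ inhomWeight p0 t p σ + prodw p σ := by
    rw [inhomWeight_append_singleton, prodw_append_singleton]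
    have h1 := mul_le_of_le_one_right hA hti
    have h2 : prodw p σ * (p0 * t i + p i) ≤ prodw p σ :=
      mul_le_of_le_one_right hP.le (by nlinarith)
    linarith
  rw [hfun_eq, hfun_eq, prodw_append_singleton s, Real.mul_rpow (prodw_pos hs σ).le (hs i).le,
    ← mul_assoc]
  have hbr : s i ^ r ≤ b ^ r := Real.rpow_le_rpow (hs i).le (hb i) hr.le
  have hsr := Real.rpow_nonneg (prodw_pos hs σ).le r
  have hsi := Real.rpow_nonneg (hs i).le r
  gcongr

lemma hfun_le_pow_length {r p0 : ℝ} {s t p : Fin N → ℝ} (hr : 0 < r) (hp0 : 0 < p0)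
    (hs : ∀ i, 0 < s i) (ht : ∀ i, 0 < t i) (hp : ∀ i, 0 < p i) (ht1 : ∑ i, t i = 1)
    (hp1 : p0 + ∑ i, p i = 1) {b : ℝ} (hb0 : 0 ≤ b) (hb : ∀ i, s i ≤ b) (σ : List (Fin N)) :
    hfun r p0 s t p σ ≤ (b ^ r) ^ σ.length := by
  induction σ using List.reverseRecOn with
  | nil => simp [hfun_nil]
  | append_singleton σ i ih =>
    rw [List.length_append, List.length_singleton, pow_succ]
    exact (hfun_append_singleton_le hr hp0 hs ht hp ht1 hp1 hb σ i).trans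
      (mul_le_mul_of_nonneg_right ih (Real.rpow_nonneg hb0 r))

/-- `h` falls below every positive level on all sufficiently long words. -/
lemma exists_length_hfun_lt {r p0 : ℝ} {s t p : Fin N → ℝ} (hr : 0 < r) (hp0 : 0 < p0)
    (hs : ∀ i, s i ∈ Set.Ioo (0 : ℝ) 1) (ht : ∀ i, 0 < t i) (hp : ∀ i, 0 < p i)
    (ht1 : ∑ i, t i = 1) (hp1 : p0 + ∑ i, p i = 1) {c : ℝ} (hc : 0 < c) :
    ∃ L : ℕ, ∀ σ : List (Fin N), L ≤ σ.length → hfun r p0 s t p σ < c := by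
  have hne : Nonempty (Fin N) := by
    by_contra h
    rw [not_nonempty_iff] at h
    simp at ht1
  obtain ⟨m, hm⟩ := Finite.exists_max s
  have hb1 : s m ^ r < 1 := Real.rpow_lt_one (hs m).1.le (hs m).2 hr
  obtain ⟨L, hL⟩ := exists_pow_lt_of_lt_one hc hb1
  refine ⟨L, fun σ hσ => ?_⟩
  calc hfun r p0 s t p σ
      ≤ (s m ^ r) ^ σ.length :=
        hfun_le_pow_length hr hp0 (fun i => (hs i).1) ht hp ht1 hp1 (hs m).1.le hm σ
    _ ≤ (s m ^ r) ^ L := pow_le_pow_of_le_one (Real.rpow_nonneg (hs m).1.le r) hb1.le hσ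
    _ < c := hL

lemma etaLow_pos {r p0 : ℝ} {s t p : Fin N → ℝ} [Nonempty (Fin N)] (hp0 : 0 < p0)
    (hs : ∀ i, 0 < s i) (ht : ∀ i, 0 < t i) (hp : ∀ i, 0 < p i) : 0 < etaLow r p0 s t p := by
  obtain ⟨i, hi⟩ := exists_eq_ciInf_of_finite
    (f := fun i => min (p0 * t i + p i) (t i) * s i ^ r)
  rw [etaLow, ← hi]
  have := hp i
  have := ht i
  have := Real.rpow_pos_of_pos (hs i) r
  positivity

lemma etaLow_le_one {r p0 : ℝ} {s t p : Fin N → ℝ} [Nonempty (Fin N)] (hr : 0 < r)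
    (hs : ∀ i, s i ∈ Set.Ioo (0 : ℝ) 1) (ht : ∀ i, 0 < t i) (ht1 : ∑ i, t i = 1) :
    etaLow r p0 s t p ≤ 1 := by
  let i := Classical.arbitrary (Fin N)
  have hti : t i ≤ 1 :=
    ht1 ▸ Finset.single_le_sum (fun j _ => (ht j).le) (Finset.mem_univ i)
  refine (ciInf_le (Set.finite_range _).bddBelow i).trans ?_
  have h1 := Real.rpow_le_one (hs i).1.le (hs i).2.le hr.le
  have h0 := Real.rpow_nonneg (hs i).1.le r
  have hmin : min (p0 * t i + p i) (t i) ≤ 1 := (min_le_right _ _).trans hti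
  nlinarith

lemma finite_Lam {r p0 : ℝ} {s t p : Fin N → ℝ} {k L : ℕ}
    (hL : ∀ σ : List (Fin N), L ≤ σ.length → hfun r p0 s t p σ < etaLow r p0 s t p / k) :
    (Lam r p0 s t p k).Finite := by
  refine (List.finite_length_le (Fin N) L).subset fun σ hσ => ?_
  by_contra hlen
  have hlen' : L < σ.length := not_le.1 hlen
  have hdrop : L ≤ σ.dropLast.length := by rw [List.length_dropLast]; omega
  exact hσ.2.1.not_gt (hL _ hdrop)

/-- A function on words that is subadditive under subdivision is bounded by its sum over the first
words at which `H` drops below the level `c`. -/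
lemma le_tsum_stopping {ι : Type*} [Fintype ι] (Φ : List ι → ENNReal)
    (hΦ : ∀ σ, Φ σ ≤ ∑ i, Φ (σ ++ [i])) (H : List ι → ℝ) (c : ℝ) (n : ℕ) (σ : List ι)
    (hn : ∀ τ : List ι, n ≤ τ.length → H (σ ++ τ) < c) (hσ : c ≤ H σ) :
    Φ σ ≤ ∑' τ, {ρ | ρ ≠ [] ∧ c ≤ H ρ.dropLast ∧ H ρ < c}.indicator Φ (σ ++ τ) := by
  induction n generalizing σ with
  | zero => exact absurd (hn [] le_rfl) (by simpa using hσ)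
  | succ n ih =>
    set S : Set (List ι) := {ρ | ρ ≠ [] ∧ c ≤ H ρ.dropLast ∧ H ρ < c}
    have hchild : ∀ i, Φ (σ ++ [i]) ≤ ∑' τ, S.indicator Φ (σ ++ (i :: τ)) := by
      intro i
      by_cases hi : c ≤ H (σ ++ [i])
      · have := ih (σ ++ [i]) (fun τ hτ => by
          simpa using hn (i :: τ) (by simpa using hτ)) hi
        simpa using this
      · have hmem : σ ++ [i] ∈ S := ⟨by simp, by simpa using hσ, not_le.1 hi⟩
        calc Φ (σ ++ [i]) = S.indicator Φ (σ ++ (i :: [])) :=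
              (Set.indicator_of_mem hmem Φ).symm
          _ ≤ _ := ENNReal.le_tsum (f := fun τ => S.indicator Φ (σ ++ (i :: τ))) []
    have hinj : Function.Injective fun x : ι × List ι => x.1 :: x.2 := by
      rintro ⟨i, τ⟩ ⟨j, ρ⟩ h
      simpa using h
    calc Φ σ ≤ ∑ i, Φ (σ ++ [i]) := hΦ σ
      _ ≤ ∑ i, ∑' τ, S.indicator Φ (σ ++ (i :: τ)) := Finset.sum_le_sum fun i _ => hchild i
      _ = ∑' x : ι × List ι, S.indicator Φ (σ ++ (x.1 :: x.2)) := by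
        rw [ENNReal.tsum_prod', tsum_fintype]
      _ ≤ ∑' τ, S.indicator Φ (σ ++ τ) :=
        ENNReal.tsum_comp_le_tsum_of_injective hinj fun τ => S.indicator Φ (σ ++ τ)

end Words

section Measures

variable {q N : ℕ} {f : Fin N → EuclideanSpace ℝ (Fin q) → EuclideanSpace ℝ (Fin q)}
  {s : Fin N → ℝ}

lemma wordMap_append_singleton (σ : List (Fin N)) (i : Fin N)
    (x : EuclideanSpace ℝ (Fin q)) : wordMap f (σ ++ [i]) x = wordMap f σ (f i x) := by
  induction σ with
  | nil => rfl
  | cons j σ ih => exact congrArg (f j) ih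

lemma dist_wordMap (hf : ∀ i x y, dist (f i x) (f i y) = s i * dist x y) (σ : List (Fin N))
    (x y : EuclideanSpace ℝ (Fin q)) :
    dist (wordMap f σ x) (wordMap f σ y) = prodw s σ * dist x y := by
  induction σ using List.reverseRecOn generalizing x y with
  | nil => simp [wordMap]
  | append_singleton σ i ih =>
    rw [wordMap_append_singleton, wordMap_append_singleton, ih, hf, prodw_append_singleton,
      mul_assoc]

lemma continuous_of_dist_eq_mul {X Y : Type*} [PseudoMetricSpace X] [PseudoMetricSpace Y]
    {g : X → Y} {a : ℝ} (hg : ∀ x y, dist (g x) (g y) = a * dist x y) : Continuous g :=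
  (LipschitzWith.of_dist_le_mul (K := a.toNNReal) fun x y => by
    rw [hg]
    exact mul_le_mul_of_nonneg_right (Real.le_coe_toNNReal a) dist_nonneg).continuous

lemma lintegral_sum_smul_map {w : Fin N → ℝ} {m : Measure (EuclideanSpace ℝ (Fin q))}
    (hfm : ∀ i, Measurable (f i)) {g : EuclideanSpace ℝ (Fin q) → ENNReal} (hg : Measurable g) :
    ∫⁻ x, g x ∂(∑ i, ENNReal.ofReal (w i) • m.map (f i))
      = ∑ i, ENNReal.ofReal (w i) * ∫⁻ x, g (f i x) ∂m := by
  rw [lintegral_finsetSum_measure]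
  exact Finset.sum_congr rfl fun i _ => by
    rw [lintegral_smul_measure, lintegral_map hg (hfm i), smul_eq_mul]

lemma infDist_image_le (hf : ∀ i x y, dist (f i x) (f i y) = s i * dist x y)
    {E : Set (EuclideanSpace ℝ (Fin q))} (hEcpt : IsCompact E) (hEne : E.Nonempty)
    (hEf : ∀ i, f i '' E ⊆ E) (i : Fin N) (x : EuclideanSpace ℝ (Fin q)) :
    Metric.infDist (f i x) E ≤ s i * Metric.infDist x E := by
  obtain ⟨y, hy, hxy⟩ := hEcpt.exists_infDist_eq_dist hEne x
  rw [hxy, ← hf]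
  exact Metric.infDist_le_dist_of_mem (hEf i ⟨y, hy, rfl⟩)

/-- A compactly supported finite measure that is dominated by a subprobability combination of its
images under contractions preserving `E`, up to a part living on `E`, lives on `E`. -/
lemma ae_mem_of_le_selfSimilar (hs : ∀ i, s i ∈ Set.Ioo (0 : ℝ) 1)
    (hf : ∀ i x y, dist (f i x) (f i y) = s i * dist x y)
    {E : Set (EuclideanSpace ℝ (Fin q))} (hEcpt : IsCompact E) (hEne : E.Nonempty)
    (hEf : ∀ i, f i '' E ⊆ E) {w : Fin N → ℝ} (hw : ∀ i, 0 < w i) (hw1 : ∑ i, w i ≤ 1)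
    {m m₀ : Measure (EuclideanSpace ℝ (Fin q))} [IsFiniteMeasure m]
    (hmc : ∃ K, IsCompact K ∧ m Kᶜ = 0) (hm₀ : ∀ᵐ x ∂m₀, x ∈ E)
    (hm : m = m₀ + ∑ i, ENNReal.ofReal (w i) • m.map (f i)) : ∀ᵐ x ∂m, x ∈ E := by
  set g : EuclideanSpace ℝ (Fin q) → ENNReal := fun x => ENNReal.ofReal (Metric.infDist x E)
    with hg
  have hcont : Continuous fun x : EuclideanSpace ℝ (Fin q) => Metric.infDist x E :=
    Metric.continuous_infDist_pt E
  have hgm : Measurable g := hcont.measurable.ennreal_ofReal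
  have hfm : ∀ i, Measurable (f i) := fun i => (continuous_of_dist_eq_mul (hf i)).measurable
  have hgtop : ∫⁻ x, g x ∂m ≠ ⊤ := by
    obtain ⟨K, hK, hmK⟩ := hmc
    obtain ⟨C, hC⟩ := (hK.image hcont).bddAbove
    have hae : ∀ᵐ x ∂m, g x ≤ ENNReal.ofReal C := by
      have hK' : ∀ᵐ x ∂m, x ∈ K := hmK
      filter_upwards [hK'] with x hx
      exact ENNReal.ofReal_le_ofReal (hC ⟨x, hx, rfl⟩)
    refine ((lintegral_mono_ae hae).trans_lt ?_).ne
    rw [lintegral_const]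
    exact ENNReal.mul_lt_top ENNReal.ofReal_lt_top (measure_lt_top _ _)
  have hm₀g : ∫⁻ x, g x ∂m₀ = 0 := by
    rw [lintegral_eq_zero_iff hgm]
    filter_upwards [hm₀] with x hx
    simp [hg, Metric.infDist_zero_of_mem hx]
  have hle : ∫⁻ x, g x ∂m ≤ ENNReal.ofReal (∑ i, w i * s i) * ∫⁻ x, g x ∂m := by
    conv_lhs => rw [hm]
    rw [lintegral_add_measure, hm₀g, zero_add, lintegral_sum_smul_map hfm hgm,
      ENNReal.ofReal_sum_of_nonneg fun i _ => mul_nonneg (hw i).le (hs i).1.le, Finset.sum_mul]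
    refine Finset.sum_le_sum fun i _ => ?_
    rw [ENNReal.ofReal_mul (hw i).le, mul_assoc, ← lintegral_const_mul _ hgm]
    gcongr with x
    rw [hg, ← ENNReal.ofReal_mul (hs i).1.le]
    exact ENNReal.ofReal_le_ofReal
      (infDist_image_le hf hEcpt hEne hEf i x)
  have hlt : ∑ i, w i * s i < 1 := by
    rcases isEmpty_or_nonempty (Fin N) with h | h
    · simp
    · exact (Finset.sum_lt_sum_of_nonempty Finset.univ_nonempty fun i _ =>
        mul_lt_of_lt_one_right (hw i) (hs i).2).trans_le hw1
  have hzero : ∫⁻ x, g x ∂m = 0 := by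
    by_contra hne
    refine absurd hle (not_le.2 ?_)
    calc ENNReal.ofReal (∑ i, w i * s i) * ∫⁻ x, g x ∂m
        < 1 * ∫⁻ x, g x ∂m := by
          rw [ENNReal.mul_lt_mul_iff_left hne hgtop]
          exact ENNReal.ofReal_lt_one.2 hlt
      _ = _ := one_mul _
  rw [lintegral_eq_zero_iff hgm] at hzero
  filter_upwards [hzero] with x hx
  have hx0 : Metric.infDist x E = 0 :=
    le_antisymm (ENNReal.ofReal_eq_zero.1 hx) Metric.infDist_nonneg
  exact (hEcpt.isClosed.mem_iff_infDist_zero hEne).2 hx0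

/-- The integral of `g` against the part of `μ` that is carried along the word `σ`. -/
noncomputable def wordIntegral (f : Fin N → EuclideanSpace ℝ (Fin q) → EuclideanSpace ℝ (Fin q))
    (p0 : ℝ) (t p : Fin N → ℝ) (ν μ : Measure (EuclideanSpace ℝ (Fin q)))
    (g : EuclideanSpace ℝ (Fin q) → ENNReal) (σ : List (Fin N)) : ENNReal :=
  ENNReal.ofReal (inhomWeight p0 t p σ) * ∫⁻ x, g (wordMap f σ x) ∂ν
    + ENNReal.ofReal (prodw p σ) * ∫⁻ x, g (wordMap f σ x) ∂μ

variable {p0 : ℝ} {t p : Fin N → ℝ} {ν μ : Measure (EuclideanSpace ℝ (Fin q))}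
  {g : EuclideanSpace ℝ (Fin q) → ENNReal}

lemma wordIntegral_nil : wordIntegral f p0 t p ν μ g [] = ∫⁻ x, g x ∂μ := by
  simp [wordIntegral, wordMap]

lemma wordIntegral_eq_sum (hf : ∀ i x y, dist (f i x) (f i y) = s i * dist x y)
    (hp0 : 0 < p0) (ht : ∀ i, 0 < t i) (hp : ∀ i, 0 < p i)
    (hνss : ν = ∑ i, ENNReal.ofReal (t i) • ν.map (f i))
    (hμss : μ = ENNReal.ofReal p0 • ν + ∑ i, ENNReal.ofReal (p i) • μ.map (f i))
    (hg : Measurable g) (σ : List (Fin N)) :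
    wordIntegral f p0 t p ν μ g σ = ∑ i, wordIntegral f p0 t p ν μ g (σ ++ [i]) := by
  have hfm : ∀ i, Measurable (f i) := fun i => (continuous_of_dist_eq_mul (hf i)).measurable
  have hG : Measurable fun x => g (wordMap f σ x) :=
    hg.comp (continuous_of_dist_eq_mul (dist_wordMap hf σ)).measurable
  have hA := inhomWeight_nonneg hp0 ht hp σ
  have hP := (prodw_pos hp σ).le
  have hνG : ∫⁻ x, g (wordMap f σ x) ∂ν
      = ∑ i, ENNReal.ofReal (t i) * ∫⁻ x, g (wordMap f σ (f i x)) ∂ν := by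
    conv_lhs => rw [hνss]
    exact lintegral_sum_smul_map hfm hG
  have hμG : ∫⁻ x, g (wordMap f σ x) ∂μ
      = ENNReal.ofReal p0 * ∫⁻ x, g (wordMap f σ x) ∂ν
        + ∑ i, ENNReal.ofReal (p i) * ∫⁻ x, g (wordMap f σ (f i x)) ∂μ := by
    conv_lhs => rw [hμss]
    rw [lintegral_add_measure, lintegral_smul_measure, lintegral_sum_smul_map hfm hG,
      smul_eq_mul]
  calc wordIntegral f p0 t p ν μ g σ
      = (ENNReal.ofReal (inhomWeight p0 t p σ) + ENNReal.ofReal (prodw p σ) * ENNReal.ofReal p0)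
          * ∫⁻ x, g (wordMap f σ x) ∂ν
        + ENNReal.ofReal (prodw p σ)
          * ∑ i, ENNReal.ofReal (p i) * ∫⁻ x, g (wordMap f σ (f i x)) ∂μ := by
        rw [wordIntegral, hμG]
        ring
    _ = _ := by
        rw [hνG, Finset.mul_sum, Finset.mul_sum, ← Finset.sum_add_distrib]
        refine Finset.sum_congr rfl fun i _ => ?_
        simp only [wordIntegral, wordMap_append_singleton, prodw_append_singleton,
          inhomWeight_append_singleton]
        rw [ENNReal.ofReal_mul (by positivity), ENNReal.ofReal_add hA (by positivity),
          ENNReal.ofReal_mul hp0.le, ENNReal.ofReal_mul hP]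
        ring

lemma wordIntegral_infDist_le {r : ℝ} (hr : 0 < r) (hs : ∀ i, 0 < s i)
    (hf : ∀ i x y, dist (f i x) (f i y) = s i * dist x y)
    {E : Set (EuclideanSpace ℝ (Fin q))} (hEcpt : IsCompact E) (hEdiam : Metric.diam E ≤ 1)
    (hp0 : 0 < p0) (ht : ∀ i, 0 < t i) (hp : ∀ i, 0 < p i)
    [IsProbabilityMeasure ν] [IsProbabilityMeasure μ]
    (hνE : ∀ᵐ x ∂ν, x ∈ E) (hμE : ∀ᵐ x ∂μ, x ∈ E) {x₀ : EuclideanSpace ℝ (Fin q)}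
    (hx₀ : x₀ ∈ E) {α : Set (EuclideanSpace ℝ (Fin q))} {σ : List (Fin N)}
    (hσ : wordMap f σ x₀ ∈ α) :
    wordIntegral f p0 t p ν μ (fun x => ENNReal.ofReal (Metric.infDist x α ^ r)) σ
      ≤ ENNReal.ofReal (hfun r p0 s t p σ) := by
  have hA := inhomWeight_nonneg hp0 ht hp σ
  have hP := (prodw_pos hp σ).le
  have hS := (prodw_pos hs σ).le
  have hpt : ∀ x ∈ E, ENNReal.ofReal (Metric.infDist (wordMap f σ x) α ^ r)
      ≤ ENNReal.ofReal (prodw s σ ^ r) := by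
    intro x hx
    refine ENNReal.ofReal_le_ofReal (Real.rpow_le_rpow Metric.infDist_nonneg ?_ hr.le)
    calc Metric.infDist (wordMap f σ x) α
        ≤ dist (wordMap f σ x) (wordMap f σ x₀) := Metric.infDist_le_dist_of_mem hσ
      _ = prodw s σ * dist x x₀ := dist_wordMap hf σ x x₀
      _ ≤ prodw s σ := mul_le_of_le_one_right hS
        ((Metric.dist_le_diam_of_mem hEcpt.isBounded hx hx₀).trans hEdiam)
  have hint : ∀ m : Measure (EuclideanSpace ℝ (Fin q)), IsProbabilityMeasure m →
      (∀ᵐ x ∂m, x ∈ E) →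
      ∫⁻ x, ENNReal.ofReal (Metric.infDist (wordMap f σ x) α ^ r) ∂m
        ≤ ENNReal.ofReal (prodw s σ ^ r) := by
    intro m _ hm
    refine (lintegral_mono_ae (hm.mono hpt)).trans_eq ?_
    simp
  rw [hfun_eq, ENNReal.ofReal_mul (add_nonneg hA hP), ENNReal.ofReal_add hA hP, add_mul]
  exact add_le_add (mul_le_mul_right (hint ν inferInstance hνE) _)
    (mul_le_mul_right (hint μ inferInstance hμE) _)

lemma quantErr_rpow_le_integral {r : ℝ} (hr : 0 < r) (P : Measure (EuclideanSpace ℝ (Fin q)))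
    {n : ℕ} {α : Finset (EuclideanSpace ℝ (Fin q))} (hα : α.Nonempty) (hn : α.card ≤ n) :
    quantErr P n r ^ r
      ≤ ∫ x, Metric.infDist x (α : Set (EuclideanSpace ℝ (Fin q))) ^ r ∂P := by
  have hint : ∀ β : Finset (EuclideanSpace ℝ (Fin q)),
      0 ≤ ∫ x, Metric.infDist x (β : Set (EuclideanSpace ℝ (Fin q))) ^ r ∂P := fun β =>
    integral_nonneg fun x => Real.rpow_nonneg Metric.infDist_nonneg r
  have hlb : ∀ y ∈ ((fun β : Finset (EuclideanSpace ℝ (Fin q)) =>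
      (∫ x, Metric.infDist x (β : Set (EuclideanSpace ℝ (Fin q))) ^ r ∂P) ^ (1 / r)) ''
      {β : Finset (EuclideanSpace ℝ (Fin q)) | β.Nonempty ∧ β.card ≤ n}), 0 ≤ y := by
    rintro _ ⟨β, -, rfl⟩
    exact Real.rpow_nonneg (hint β) _
  have hle : quantErr P n r
      ≤ (∫ x, Metric.infDist x (α : Set (EuclideanSpace ℝ (Fin q))) ^ r ∂P) ^ (1 / r) :=
    csInf_le ⟨0, hlb⟩ ⟨α, ⟨hα, hn⟩, rfl⟩
  calc quantErr P n r ^ r ≤ _ := Real.rpow_le_rpow (Real.sInf_nonneg hlb) hle hr.le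
    _ = _ := by rw [← Real.rpow_mul (hint α), one_div_mul_cancel hr.ne', Real.rpow_one]

lemma quantErr_zero {r : ℝ} (P : Measure (EuclideanSpace ℝ (Fin q))) : quantErr P 0 r = 0 := by
  have hempty : {α : Finset (EuclideanSpace ℝ (Fin q)) | α.Nonempty ∧ α.card ≤ 0} = ∅ := by
    ext α
    simp [Finset.nonempty_iff_ne_empty]
  rw [quantErr, hempty, Set.image_empty, Real.sInf_empty]

end Measures

/-- Lemma (Zhu): under the OSC, `e_{N_{k,r},r}(μ)^r ≤ Σ_{σ ∈ Λ_{k,r}} h(σ)` for all `k ≥ 1`. -/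
theorem quantErr_le_sum_h_over_antichain
    (q N : ℕ) (hq : 1 ≤ q) (hN : 2 ≤ N) (r : ℝ) (hr : 0 < r)
    (f : Fin N → EuclideanSpace ℝ (Fin q) → EuclideanSpace ℝ (Fin q))
    (s : Fin N → ℝ) (hs : ∀ i, s i ∈ Set.Ioo (0 : ℝ) 1)
    (hf : ∀ i x y, dist (f i x) (f i y) = s i * dist x y)
    (E : Set (EuclideanSpace ℝ (Fin q)))
    (hEcpt : IsCompact E) (hEne : E.Nonempty) (hEss : E = ⋃ i, f i '' E)
    (hEdiam : Metric.diam E = 1)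
    (hOSC : ∃ U : Set (EuclideanSpace ℝ (Fin q)), U.Nonempty ∧ IsOpen U ∧
      (∀ i, f i '' U ⊆ U) ∧ Pairwise fun i j => Disjoint (f i '' U) (f j '' U))
    (t : Fin N → ℝ) (ht : ∀ i, 0 < t i) (ht1 : ∑ i, t i = 1)
    (ν : Measure (EuclideanSpace ℝ (Fin q))) (hνP : IsProbabilityMeasure ν)
    (hνc : ∃ K, IsCompact K ∧ ν Kᶜ = 0)
    (hνss : ν = ∑ i, ENNReal.ofReal (t i) • ν.map (f i))
    (p0 : ℝ) (p : Fin N → ℝ) (hp0 : 0 < p0) (hp : ∀ i, 0 < p i)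
    (hp1 : p0 + ∑ i, p i = 1)
    (μ : Measure (EuclideanSpace ℝ (Fin q))) (hμP : IsProbabilityMeasure μ)
    (hμc : ∃ K, IsCompact K ∧ μ Kᶜ = 0)
    (hμss : μ = ENNReal.ofReal p0 • ν + ∑ i, ENNReal.ofReal (p i) • μ.map (f i))
    :
    ∀ k : ℕ, 1 ≤ k →
      quantErr μ ((Lam r p0 s t p k).ncard) r ^ r
        ≤ ∑ᶠ σ ∈ Lam r p0 s t p k, hfun r p0 s t p σ := by
  classical
  intro k hk
  have hs0 : ∀ i, 0 < s i := fun i => (hs i).1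
  have : Nonempty (Fin N) := ⟨⟨0, by omega⟩⟩
  have hEf : ∀ i, f i '' E ⊆ E := fun i => by
    conv_rhs => rw [hEss]
    exact Set.subset_iUnion (fun i => f i '' E) i
  have hνE : ∀ᵐ x ∂ν, x ∈ E := by
    refine ae_mem_of_le_selfSimilar (m₀ := 0) hs hf hEcpt hEne hEf ht ht1.le hνc (by simp) ?_
    rw [zero_add]
    exact hνss
  have hμE : ∀ᵐ x ∂μ, x ∈ E :=
    ae_mem_of_le_selfSimilar hs hf hEcpt hEne hEf hp (by linarith) hμc
      (Measure.ae_smul_measure hνE _) hμss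
  have hk' : (1 : ℝ) ≤ k := by exact_mod_cast hk
  have hη := etaLow_pos (r := r) hp0 hs0 ht hp
  have hc : 0 < etaLow r p0 s t p / k := by positivity
  have hc1 : etaLow r p0 s t p / k ≤ hfun r p0 s t p [] := by
    rw [hfun_nil]
    exact div_le_one_of_le₀ ((etaLow_le_one hr hs ht ht1).trans hk') (by linarith)
  obtain ⟨L, hL⟩ := exists_length_hfun_lt hr hp0 hs ht hp ht1 hp1 hc
  have hfin : (Lam r p0 s t p k).Finite := finite_Lam hL
  have hh := hfun_nonneg (r := r) hp0 hs0 ht hp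
  rw [finsum_mem_eq_finite_toFinset_sum _ hfin, Set.ncard_eq_toFinset_card _ hfin]
  obtain ⟨x₀, hx₀⟩ := hEne
  rcases hfin.toFinset.eq_empty_or_nonempty with hΛ | hΛ
  · rw [hΛ, Finset.card_empty, Finset.sum_empty, quantErr_zero, Real.zero_rpow hr.ne']
  set α : Finset (EuclideanSpace ℝ (Fin q)) := hfin.toFinset.image fun σ => wordMap f σ x₀
  refine (quantErr_rpow_le_integral (α := α) hr μ (hΛ.image _) Finset.card_image_le).trans ?_
  have hcont : Continuous fun x => Metric.infDist x (α : Set (EuclideanSpace ℝ (Fin q))) ^ r :=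
    (Metric.continuous_infDist_pt _).rpow_const fun _ => Or.inr hr.le
  rw [integral_eq_lintegral_of_nonneg_ae
    (ae_of_all _ fun x => Real.rpow_nonneg Metric.infDist_nonneg r) hcont.aestronglyMeasurable]
  refine ENNReal.toReal_le_of_le_ofReal (Finset.sum_nonneg fun σ _ => hh σ) ?_
  set g : EuclideanSpace ℝ (Fin q) → ENNReal := fun x =>
    ENNReal.ofReal (Metric.infDist x (α : Set (EuclideanSpace ℝ (Fin q))) ^ r) with hg
  have hgm : Measurable g := hcont.measurable.ennreal_ofReal
  calc ∫⁻ x, g x ∂μ = wordIntegral f p0 t p ν μ g [] := wordIntegral_nil.symm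
    _ ≤ ∑' τ, (Lam r p0 s t p k).indicator (wordIntegral f p0 t p ν μ g) ([] ++ τ) :=
      le_tsum_stopping _ (fun σ => (wordIntegral_eq_sum hf hp0 ht hp hνss hμss hgm σ).le)
        (hfun r p0 s t p) _ L [] hL hc1
    _ = ∑ σ ∈ hfin.toFinset, wordIntegral f p0 t p ν μ g σ := by
      rw [tsum_eq_sum (s := hfin.toFinset) fun σ hσ =>
        Set.indicator_of_notMem (by simpa using hσ) _]
      exact Finset.sum_congr rfl fun σ hσ => Set.indicator_of_mem (by simpa using hσ) _
    _ ≤ ∑ σ ∈ hfin.toFinset, ENNReal.ofReal (hfun r p0 s t p σ) :=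
      Finset.sum_le_sum fun σ hσ => wordIntegral_infDist_le hr hs0 hf hEcpt hEdiam.le hp0 ht hp
        hνE hμE hx₀ (Finset.mem_coe.2 (Finset.mem_image_of_mem _ hσ))
    _ = ENNReal.ofReal (∑ σ ∈ hfin.toFinset, hfun r p0 s t p σ) :=
      (ENNReal.ofReal_sum_of_nonneg fun σ _ => hh σ).symm
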